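/- Let s : ℝ × ℝ → ℝ be a strictly 𝓕₀-consistent scoring function for the mode, and let x₁ ≤ x₂ be real numbers. Then s(x₁, y) = s(x₂, y) for Lebesgue almost all y ∈ ℝ with y ∉ (x₁, x₂). -/

import Mathlib

open MeasureTheory Set Filter

/-- `f` belongs to `𝓕₀` with mode `x₀`: continuous, nonnegative, integrates to 1,
nondecreasing on `(-∞, x₀]`, nonincreasing on `[x₀, ∞)`, and `x₀` is the unique
local (hence global) maximum. -/
def IsUnimodalDensity (f : ℝ → ℝ) (x₀ : ℝ) : Prop :=
  Continuous f ∧ (∀ y, 0 ≤ f y) ∧ (∫ y : ℝ, f y) = 1 ∧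
    MonotoneOn f (Set.Iic x₀) ∧ AntitoneOn f (Set.Ici x₀) ∧
    ∀ x, x ≠ x₀ → f x < f x₀

/-- `f` belongs to the class `𝓕₀` of strictly unimodal distributions with
continuous Lebesgue density. -/
def MemF0 (f : ℝ → ℝ) : Prop := ∃ x₀, IsUnimodalDensity f x₀

/-- `s` is a strictly `𝓕₀`-consistent scoring function for the mode. -/
def StrictlyF0Consistent (s : ℝ × ℝ → ℝ) : Prop :=
  Measurable s ∧
  (∀ x : ℝ, ∀ f : ℝ → ℝ, MemF0 f → Integrable (fun y => |s (x, y)| * f y)) ∧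
  (∀ f : ℝ → ℝ, ∀ t : ℝ, IsUnimodalDensity f t → ∀ x : ℝ,
    (∫ y : ℝ, s (t, y) * f y) ≤ (∫ y : ℝ, s (x, y) * f y) ∧
    ((∫ y : ℝ, s (t, y) * f y) = (∫ y : ℝ, s (x, y) * f y) → x = t))

/-- `v` is a strict `𝓕₀`-identification function for the mode. -/
def StrictF0Identification (v : ℝ × ℝ → ℝ) : Prop :=
  Measurable v ∧
  (∀ x : ℝ, ∀ f : ℝ → ℝ, MemF0 f → Integrable (fun y => |v (x, y)| * f y)) ∧
  (∀ f : ℝ → ℝ, ∀ t : ℝ, IsUnimodalDensity f t → ∀ x : ℝ,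
    (∫ y : ℝ, v (x, y) * f y) = 0 ↔ x = t)

/-- Trapezoid on `[u, v]` plus a small tent at `t`. -/
noncomputable def bumpFn (u v t : ℝ) (n : ℕ) (y : ℝ) : ℝ :=
  max 0 (1 - ((n : ℝ) + 1) * (max 0 (u - y) + max 0 (y - v)))
    + (1 / ((n : ℝ) + 1)) * max 0 (1 - |y - t|)

lemma bumpFn_continuous (u v t : ℝ) (n : ℕ) : Continuous (bumpFn u v t n) := by
  unfold bumpFn
  fun_prop

lemma bumpFn_nonneg (u v t : ℝ) (n : ℕ) (y : ℝ) : 0 ≤ bumpFn u v t n y := by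
  unfold bumpFn
  have := le_max_left 0 (1 - ((n : ℝ) + 1) * (max 0 (u - y) + max 0 (y - v)))
  have := le_max_left 0 (1 - |y - t|)
  positivity

lemma bumpFn_le_two (u v t : ℝ) (n : ℕ) (y : ℝ) : bumpFn u v t n y ≤ 2 := by
  unfold bumpFn
  have h1 : max 0 (1 - ((n : ℝ) + 1) * (max 0 (u - y) + max 0 (y - v))) ≤ 1 := by
    apply max_le zero_le_one
    have := le_max_left 0 (u - y)
    have := le_max_left 0 (y - v)
    have : 0 ≤ ((n : ℝ) + 1) * (max 0 (u - y) + max 0 (y - v)) := by positivity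
    linarith
  have h2 : max 0 (1 - |y - t|) ≤ 1 := max_le zero_le_one (by linarith [abs_nonneg (y - t)])
  have h3 : 1 / ((n : ℝ) + 1) ≤ 1 := by
    rw [div_le_one (by positivity)]
    linarith [n.cast_nonneg (α := ℝ)]
  have := mul_le_one₀ h3 (le_max_left _ _) h2
  linarith

lemma bumpFn_eq_zero {u v t : ℝ} (n : ℕ) {y : ℝ} (ht : t ∈ Icc u v)
    (hy : y ∉ Icc (u - 1) (v + 1)) : bumpFn u v t n y = 0 := by
  unfold bumpFn
  obtain ⟨h1, h2⟩ := ht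
  have hn : (0 : ℝ) ≤ n := n.cast_nonneg
  have ha := le_max_left 0 (u - y)
  have hb := le_max_left 0 (y - v)
  have ha' := le_max_right 0 (u - y)
  have hb' := le_max_right 0 (y - v)
  have hD : 1 ≤ max 0 (u - y) + max 0 (y - v) ∧ 1 ≤ |y - t| := by
    rw [mem_Icc, not_and_or, not_le, not_le] at hy
    rcases hy with hy | hy
    · exact ⟨by linarith, by rw [abs_of_nonpos] <;> linarith⟩
    · exact ⟨by linarith, by rw [abs_of_nonneg] <;> linarith⟩
  rw [max_eq_left, max_eq_left]
  · simp
  · linarith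
  · nlinarith

lemma bumpFn_one_le {u v t : ℝ} (n : ℕ) {y : ℝ} (hy : y ∈ Icc u v) :
    bumpFn u v t n y = 1 + (1 / ((n : ℝ) + 1)) * max 0 (1 - |y - t|) := by
  unfold bumpFn
  rw [max_eq_left (a := 0) (b := u - y) (by linarith [hy.1]),
    max_eq_left (a := 0) (b := y - v) (by linarith [hy.2])]
  simp

lemma bumpFn_lt {u v t : ℝ} (n : ℕ) {y : ℝ} (ht : t ∈ Icc u v) (hy : y ≠ t) :
    bumpFn u v t n y < bumpFn u v t n t := by
  rw [bumpFn_one_le n ht]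
  unfold bumpFn
  have h1 : max 0 (1 - ((n : ℝ) + 1) * (max 0 (u - y) + max 0 (y - v))) ≤ 1 := by
    apply max_le zero_le_one
    have := le_max_left 0 (u - y)
    have := le_max_left 0 (y - v)
    have : 0 ≤ ((n : ℝ) + 1) * (max 0 (u - y) + max 0 (y - v)) := by positivity
    linarith
  have h2 : max 0 (1 - |y - t|) < max 0 (1 - |t - t|) := by
    have := abs_pos.2 (sub_ne_zero.2 hy)
    simp [this]
  have h3 : 0 < 1 / ((n : ℝ) + 1) := by positivity
  have := mul_lt_mul_of_pos_left h2 h3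
  linarith

lemma bumpFn_mono {u v t : ℝ} (n : ℕ) (ht : t ∈ Icc u v) :
    MonotoneOn (bumpFn u v t n) (Iic t) := by
  intro a ha b hb hab
  simp only [mem_Iic] at ha hb
  unfold bumpFn
  rw [max_eq_left (a := 0) (b := a - v) (by linarith [ht.2]),
    max_eq_left (a := 0) (b := b - v) (by linarith [ht.2]),
    abs_of_nonpos (a := a - t) (by linarith), abs_of_nonpos (a := b - t) (by linarith)]
  gcongr

lemma bumpFn_anti {u v t : ℝ} (n : ℕ) (ht : t ∈ Icc u v) :
    AntitoneOn (bumpFn u v t n) (Ici t) := by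
  intro a ha b hb hab
  simp only [mem_Ici] at ha hb
  unfold bumpFn
  rw [max_eq_left (a := 0) (b := u - a) (by linarith [ht.1]),
    max_eq_left (a := 0) (b := u - b) (by linarith [ht.1]),
    abs_of_nonneg (a := a - t) (by linarith), abs_of_nonneg (a := b - t) (by linarith)]
  gcongr

lemma bumpFn_integral_pos {u v t : ℝ} (n : ℕ) (ht : t ∈ Icc u v) :
    0 < ∫ y, bumpFn u v t n y := by
  apply (bumpFn_continuous u v t n).integral_pos_of_hasCompactSupport_nonneg_nonzero (x := t)
  · exact HasCompactSupport.intro (isCompact_Icc (a := u - 1) (b := v + 1))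
      fun y hy => bumpFn_eq_zero n ht hy
  · exact fun y => bumpFn_nonneg u v t n y
  · have := bumpFn_lt n ht (y := t + 1) (by simp)
    exact ((bumpFn_nonneg u v t n _).trans_lt this).ne'

lemma bumpFn_density {u v t : ℝ} (n : ℕ) (ht : t ∈ Icc u v) :
    IsUnimodalDensity (fun y => (∫ z, bumpFn u v t n z)⁻¹ * bumpFn u v t n y) t := by
  have hp := bumpFn_integral_pos n ht
  have hi := inv_pos.2 hp
  refine ⟨continuous_const.mul (bumpFn_continuous u v t n),
    fun y => mul_nonneg hi.le (bumpFn_nonneg _ _ _ _ _), ?_, ?_, ?_, ?_⟩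
  · rw [integral_const_mul, inv_mul_cancel₀ hp.ne']
  · exact fun a ha b hb hab => mul_le_mul_of_nonneg_left (bumpFn_mono n ht ha hb hab) hi.le
  · exact fun a ha b hb hab => mul_le_mul_of_nonneg_left (bumpFn_anti n ht ha hb hab) hi.le
  · exact fun y hy => mul_lt_mul_of_pos_left (bumpFn_lt n ht hy) hi

lemma bumpFn_integral_le {s : ℝ × ℝ → ℝ} (hs : StrictlyF0Consistent s)
    {u v t : ℝ} (n : ℕ) (ht : t ∈ Icc u v) (x : ℝ) :
    ∫ y, s (t, y) * bumpFn u v t n y ≤ ∫ y, s (x, y) * bumpFn u v t n y := by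
  have hi := inv_pos.2 (bumpFn_integral_pos n ht)
  have := (hs.2.2 _ t (bumpFn_density n ht) x).1
  simp only [mul_left_comm (s _)] at this
  rw [integral_const_mul, integral_const_mul] at this
  exact le_of_mul_le_mul_left this hi

lemma score_integrableOn {s : ℝ × ℝ → ℝ} (hs : StrictlyF0Consistent s) (x u v : ℝ) :
    IntegrableOn (fun y => s (x, y)) (Icc u v) := by
  rcases lt_or_ge v u with huv | huv
  · simp [Icc_eq_empty_of_lt huv]
  have ht : u ∈ Icc u v := ⟨le_rfl, huv⟩
  have hm : Measurable (fun y => s (x, y)) := hs.1.comp (by fun_prop)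
  have h := hs.2.1 x _ ⟨u, bumpFn_density 0 ht⟩
  have h2 := (h.const_mul (∫ z, bumpFn u v u 0 z)).integrableOn (s := Icc u v)
  refine Integrable.mono' h2 hm.aestronglyMeasurable ?_
  refine (ae_restrict_iff' measurableSet_Icc).2 (Eventually.of_forall fun y hy => ?_)
  have hp := bumpFn_integral_pos 0 ht
  have h1 : 1 ≤ bumpFn u v u 0 y := by
    rw [bumpFn_one_le 0 hy]
    have := le_max_left 0 (1 - |y - u|)
    have : 0 ≤ (1 / (((0 : ℕ) : ℝ) + 1)) * max 0 (1 - |y - u|) := by positivity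
    linarith
  have : (∫ z, bumpFn u v u 0 z) * (|s (x, y)| * ((∫ z, bumpFn u v u 0 z)⁻¹ * bumpFn u v u 0 y))
      = |s (x, y)| * bumpFn u v u 0 y := by field_simp
  rw [this, Real.norm_eq_abs]
  exact le_mul_of_one_le_right (abs_nonneg _) h1

lemma bumpFn_tendsto {u v t : ℝ} (y : ℝ) :
    Tendsto (fun n => bumpFn u v t n y) atTop (nhds ((Icc u v).indicator 1 y)) := by
  have h0 : Tendsto (fun n : ℕ => 1 / ((n : ℝ) + 1) * max 0 (1 - |y - t|)) atTop (nhds 0) := by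
    simpa using tendsto_one_div_add_atTop_nhds_zero_nat.mul_const (max 0 (1 - |y - t|))
  by_cases hy : y ∈ Icc u v
  · simp only [bumpFn_one_le _ hy, indicator_of_mem hy]
    simpa using h0.const_add 1
  · rw [indicator_of_notMem hy]
    refine h0.congr' ?_
    have hD : 0 < max 0 (u - y) + max 0 (y - v) := by
      have ha := le_max_left 0 (u - y)
      have hb := le_max_left 0 (y - v)
      have ha' := le_max_right 0 (u - y)
      have hb' := le_max_right 0 (y - v)
      rw [mem_Icc, not_and_or, not_le, not_le] at hy
      rcases hy with hy | hy <;> linarith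
    obtain ⟨N, hN⟩ := exists_nat_gt (1 / (max 0 (u - y) + max 0 (y - v)))
    filter_upwards [eventually_ge_atTop N] with n hn
    unfold bumpFn
    rw [div_lt_iff₀ hD] at hN
    have : (N : ℝ) ≤ n := by exact_mod_cast hn
    rw [max_eq_left (a := 0) (b := 1 - ((n : ℝ) + 1) * (max 0 (u - y) + max 0 (y - v)))]
    · simp
    · nlinarith

lemma score_tendsto {s : ℝ × ℝ → ℝ} (hs : StrictlyF0Consistent s) (x : ℝ)
    {u v t : ℝ} (ht : t ∈ Icc u v) :
    Tendsto (fun n => ∫ y, s (x, y) * bumpFn u v t n y) atTop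
      (nhds (∫ y in Icc u v, s (x, y))) := by
  have hm : Measurable (fun y => s (x, y)) := hs.1.comp (by fun_prop)
  rw [← integral_indicator measurableSet_Icc]
  apply tendsto_integral_of_dominated_convergence
    ((Icc (u - 1) (v + 1)).indicator fun y => ‖s (x, y)‖ * 2)
  · exact fun n => (hm.mul (bumpFn_continuous u v t n).measurable).aestronglyMeasurable
  · rw [integrable_indicator_iff measurableSet_Icc]
    exact (score_integrableOn hs x _ _).norm.mul_const 2
  · refine fun n => Eventually.of_forall fun y => ?_
    by_cases hy : y ∈ Icc (u - 1) (v + 1)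
    · rw [indicator_of_mem hy, norm_mul, Real.norm_of_nonneg (bumpFn_nonneg _ _ _ _ _)]
      exact mul_le_mul_of_nonneg_left (bumpFn_le_two _ _ _ _ _) (norm_nonneg _)
    · rw [indicator_of_notMem hy, bumpFn_eq_zero n ht hy]
      simp
  · refine Eventually.of_forall fun y => ?_
    have := (bumpFn_tendsto (u := u) (v := v) (t := t) y).const_mul (s (x, y))
    by_cases hy : y ∈ Icc u v <;> simpa [hy] using this

lemma score_integral_le {s : ℝ × ℝ → ℝ} (hs : StrictlyF0Consistent s) (x : ℝ)
    {u v t : ℝ} (ht : t ∈ Icc u v) :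
    ∫ y in Icc u v, s (t, y) ≤ ∫ y in Icc u v, s (x, y) :=
  le_of_tendsto_of_tendsto' (score_tendsto hs t ht) (score_tendsto hs x ht)
    fun n => bumpFn_integral_le hs n ht x

/-- Lemma 1: if `s` is strictly 𝓕₀-consistent for the mode and `x₁ ≤ x₂`, then
`s(x₁, y) = s(x₂, y)` for Lebesgue almost all `y ∉ (x₁, x₂)`. -/
theorem score_ae_eq_off_interval (s : ℝ × ℝ → ℝ) (hs : StrictlyF0Consistent s)
    (x₁ x₂ : ℝ) (h : x₁ ≤ x₂) :
    ∀ᵐ y : ℝ, y ∉ Set.Ioo x₁ x₂ → s (x₁, y) = s (x₂, y) := by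
  have hz : ∀ u v, u ≤ x₁ → x₂ ≤ v → ∫ y in u..v, (s (x₁, y) - s (x₂, y)) = 0 := by
    intro u v hu hv
    rw [intervalIntegral.integral_of_le (by linarith), ← integral_Icc_eq_integral_Ioc,
      integral_sub (score_integrableOn hs _ _ _) (score_integrableOn hs _ _ _), sub_eq_zero]
    exact le_antisymm (score_integral_le hs _ ⟨hu, h.trans hv⟩)
      (score_integral_le hs _ ⟨hu.trans h, hv⟩)
  have hloc : LocallyIntegrable (fun y => s (x₁, y) - s (x₂, y)) volume := by
    rw [locallyIntegrable_iff]
    intro K hK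
    obtain ⟨a, ha⟩ := hK.bddBelow
    obtain ⟨b, hb⟩ := hK.bddAbove
    exact ((score_integrableOn hs x₁ a b).sub (score_integrableOn hs x₂ a b)).mono_set
      fun y hy => ⟨ha hy, hb hy⟩
  have h1 : ∀ᵐ y : ℝ, y ≠ x₁ := by simp [ae_iff]
  have h2 : ∀ᵐ y : ℝ, y ≠ x₂ := by simp [ae_iff]
  filter_upwards [LocallyIntegrable.ae_hasDerivAt_integral hloc, h1, h2] with y hy hy1 hy2 hn
  rw [mem_Ioo, not_and_or, not_lt, not_lt] at hn
  rw [← sub_eq_zero]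
  rcases hn with hn | hn
  · have hlt : y < x₁ := lt_of_le_of_ne hn hy1
    refine (hy x₂).unique ((hasDerivAt_const y (0 : ℝ)).congr_of_eventuallyEq ?_)
    filter_upwards [Iio_mem_nhds hlt] with z hz'
    rw [intervalIntegral.integral_symm, hz z x₂ (le_of_lt hz') le_rfl, neg_zero]
  · have hlt : x₂ < y := lt_of_le_of_ne hn (Ne.symm hy2)
    refine (hy x₁).unique ((hasDerivAt_const y (0 : ℝ)).congr_of_eventuallyEq ?_)
    filter_upwards [Ioi_mem_nhds hlt] with z hz'
    exact hz x₁ z le_rfl (le_of_lt hz')
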